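/- Let A be a unital simple C*-algebra with T(A) ≠ ∅ and let a ∈ A be a nonzero positive element. Let 𝒜 be the set of continuous affine functions h : T(A) → ℝ which are either identically zero or satisfy h(τ) > 0 for all τ ∈ T(A). Define α := inf_{h∈𝒜} sup_{τ∈T(A)} |d_τ(a) − h(τ)|; β := inf{ sup_{τ∈T(A)} (d_τ(a) − h(τ)) : h ∈ 𝒜, h(τ) ≤ d_τ(a) for all τ }; γ := inf{ sup_{τ∈T(A)} (d_τ(a) − h(τ)) : h ∈ 𝒜, h(τ) < d_τ(a) for all τ }. Then α ≤ β = γ = ω(a) ≤ 2α. -/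

import Mathlib

open scoped ComplexOrder

/-- A tracial state on a C*-algebra: a positive linear functional of norm one which is
tracial (`τ(xy) = τ(yx)`). -/
def IsTracialState {A : Type*} [NonUnitalNormedRing A] [StarRing A] [NormedSpace ℂ A]
    (τ : A →L[ℂ] ℂ) : Prop :=
  (∀ x : A, 0 ≤ τ (star x * x)) ∧ ‖τ‖ = 1 ∧ ∀ x y : A, τ (x * y) = τ (y * x)

/-- The set `T(A)` of tracial states of `A`. -/
def traceSet (A : Type*) [CStarAlgebra A] : Set (A →L[ℂ] ℂ) := {τ | IsTracialState τ}

/-- The function `f_ε : ℝ → [0,1]`: `0` on `(-∞, ε]`, `1` on `[2ε, ∞)`, linear on `[ε, 2ε]`. -/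
noncomputable def fE (ε : ℝ) : ℝ → ℝ := fun t => min 1 (max 0 ((t - ε) / ε))

variable {A : Type*} [CStarAlgebra A]

/-- `d_τ(a) := sup_n τ(f_{1/n}(a))`. -/
noncomputable def dTau (τ : A →L[ℂ] ℂ) (a : A) : ℝ :=
  ⨆ n : ℕ, (τ (cfc (fE (1 / (n + 1 : ℝ))) a)).re

/-- The tracial oscillation `ω(a) = lim_n sup_{τ ∈ T(A)} (d_τ(a) − τ(f_{1/n}(a)))`; since the
sequence of suprema is nonincreasing, the limit is the infimum. -/
noncomputable def osc (a : A) : ℝ :=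
  ⨅ n : ℕ, ⨆ τ : ↥(traceSet A),
    (dTau (τ : A →L[ℂ] ℂ) a - ((τ : A →L[ℂ] ℂ) (cfc (fE (1 / (n + 1 : ℝ))) a)).re)

/-- The weak-* topology on a set of continuous linear functionals: the topology induced from
the product topology on `A → ℂ` via pointwise evaluation. -/
noncomputable def wstar (S : Set (A →L[ℂ] ℂ)) : TopologicalSpace S :=
  TopologicalSpace.induced (fun φ => ((φ : A →L[ℂ] ℂ) : A → ℂ)) Pi.topologicalSpace

/-- Continuity of a real-valued function on a set of functionals, for the weak-* topology. -/
def IsWstarContinuous {S : Set (A →L[ℂ] ℂ)} (h : S → ℝ) : Prop :=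
  @Continuous _ _ (wstar S) _ h

/-- Affinity of a real-valued function on a (convex) set of functionals. -/
def IsAffineOn {S : Set (A →L[ℂ] ℂ)} (h : S → ℝ) : Prop :=
  ∀ (φ ψ : S) (t : ℝ), t ∈ Set.Icc (0 : ℝ) 1 →
    ∀ hmem : t • (φ : A →L[ℂ] ℂ) + (1 - t) • (ψ : A →L[ℂ] ℂ) ∈ S,
      h ⟨_, hmem⟩ = t * h φ + (1 - t) * h ψ

section MonotoneLimit

variable {X : Type*} [TopologicalSpace X]

/-- A one-sided version of Dini's theorem: a continuous function lying strictly below the supremum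
of an increasing sequence of continuous functions lies strictly below one of its terms. -/
theorem exists_forall_lt_of_lt_iSup [CompactSpace X] {H : ℕ → X → ℝ} (hH : ∀ n, Continuous (H n))
    (hmono : Monotone H) {g : X → ℝ} (hg : Continuous g) (hlt : ∀ x, g x < ⨆ n, H n x) :
    ∃ n, ∀ x, g x < H n x := by
  have hdir : Directed (· ⊆ ·) fun n => {x | g x < H n x} :=
    Monotone.directed_le fun m n hmn x hx => lt_of_lt_of_le hx (hmono hmn x)
  obtain ⟨n, hn⟩ := isCompact_univ.elim_directed_cover (fun n => {x | g x < H n x})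
    (fun n => isOpen_lt hg (hH n))
    (fun x _ => Set.mem_iUnion.2 (exists_lt_of_lt_ciSup (hlt x))) hdir
  exact ⟨n, fun x => hn (Set.mem_univ x)⟩

theorem bddAbove_range_abs_sub [CompactSpace X] {d h : X → ℝ} (hd0 : ∀ x, 0 ≤ d x) (hd1 : ∀ x, d x ≤ 1)
    (hh : Continuous h) : BddAbove (Set.range fun x => |d x - h x|) := by
  obtain ⟨C, hC⟩ := (isCompact_range hh.abs).bddAbove
  refine ⟨1 + C, ?_⟩
  rintro _ ⟨x, rfl⟩
  have h1 : |h x| ≤ C := hC ⟨x, rfl⟩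
  have h2 := abs_sub (d x) (h x)
  have h3 : |d x| ≤ 1 := abs_le.2 ⟨by linarith [hd0 x], hd1 x⟩
  simp only
  linarith

/-- The approximation argument: for the pointwise supremum `d` of an increasing sequence `H` of
continuous functions with values in `[0, 1]`, the oscillation of `d` along `H` agrees with the
distance of `d` to the functions of `𝒜` below `d`, provided that `𝒜` consists of continuous
functions and contains the positive multiples of `H n` for large `n`. -/
theorem iInf_iSup_sub_eq_sInf [CompactSpace X] [Nonempty X] {H : ℕ → X → ℝ} (hH : ∀ n, Continuous (H n))
    (hmono : Monotone H) (h0 : ∀ n x, 0 ≤ H n x) (h1 : ∀ n x, H n x ≤ 1)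
    {𝒜 : Set (X → ℝ)} (h𝒜 : ∀ h ∈ 𝒜, Continuous h) {N : ℕ} (hpos : ∀ x, 0 < H N x)
    (hmem : ∀ n, N ≤ n → ∀ t : ℝ, 0 < t → t • H n ∈ 𝒜)
    {d : X → ℝ} (hd : ∀ x, d x = ⨆ n, H n x)
    {α β γ ω : ℝ} (hα : α = sInf {r : ℝ | ∃ h ∈ 𝒜, r = ⨆ x, |d x - h x|})
    (hβ : β = sInf {r : ℝ | ∃ h ∈ 𝒜, (∀ x, h x ≤ d x) ∧ r = ⨆ x, (d x - h x)})
    (hγ : γ = sInf {r : ℝ | ∃ h ∈ 𝒜, (∀ x, h x < d x) ∧ r = ⨆ x, (d x - h x)})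
    (hω : ω = ⨅ n, ⨆ x, (d x - H n x)) :
    α ≤ β ∧ β = γ ∧ γ = ω ∧ ω ≤ 2 * α := by
  have hle : ∀ n x, H n x ≤ d x := fun n x => by
    rw [hd]
    exact le_ciSup (f := fun n => H n x) ⟨1, by rintro _ ⟨n, rfl⟩; exact h1 n x⟩ n
  have hd0 : ∀ x, 0 ≤ d x := fun x => (h0 0 x).trans (hle 0 x)
  have hd1 : ∀ x, d x ≤ 1 := fun x => by rw [hd]; exact ciSup_le fun n => h1 n x
  have habs : ∀ h : X → ℝ, Continuous h → BddAbove (Set.range fun x => |d x - h x|) :=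
    fun h hh => bddAbove_range_abs_sub hd0 hd1 hh
  have hsub : ∀ h : X → ℝ, Continuous h → BddAbove (Set.range fun x => d x - h x) :=
    fun h hh => (habs h hh).range_mono _ fun x => le_abs_self _
  have hωle : ∀ n, ω ≤ ⨆ x, (d x - H n x) := fun n => by
    rw [hω]
    refine ciInf_le ⟨0, ?_⟩ n
    rintro _ ⟨n, rfl⟩
    exact Real.iSup_nonneg fun x => sub_nonneg.2 (hle n x)
  have hωlt : ∀ (h : X → ℝ) (c s : ℝ), Continuous h → (∀ x, d x - h x ≤ s) →
      (∀ x, h x - c ≤ d x) → ω ≤ s + c := by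
    intro h c s hh hs hc
    refine le_of_forall_pos_le_add fun ε hε => ?_
    obtain ⟨n, hn⟩ := exists_forall_lt_of_lt_iSup hH hmono (g := fun x => h x - c - ε)
      (by fun_prop) (fun x => by rw [← hd]; linarith [hc x])
    refine (hωle n).trans (ciSup_le fun x => ?_)
    linarith [hn x, hs x]
  have hbdd : ∀ P : (X → ℝ) → Prop, (∀ h, P h → ∀ x, h x ≤ d x) →
      BddBelow {r : ℝ | ∃ h ∈ 𝒜, P h ∧ r = ⨆ x, (d x - h x)} := by
    rintro P hP
    refine ⟨0, ?_⟩
    rintro _ ⟨h, -, hh, rfl⟩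
    exact Real.iSup_nonneg fun x => sub_nonneg.2 (hP h hh x)
  have hlt : ∀ n, N ≤ n → ∀ t : ℝ, 0 < t → t < 1 → ∀ x, (t • H n) x < d x := by
    intro n hn t ht ht1 x
    have h2 : 0 < H n x := (hpos x).trans_le (hmono hn x)
    have h3 := hle n x
    simp only [Pi.smul_apply, smul_eq_mul]
    nlinarith
  have hγne : {r : ℝ | ∃ h ∈ 𝒜, (∀ x, h x < d x) ∧ r = ⨆ x, (d x - h x)}.Nonempty :=
    ⟨_, _, hmem N le_rfl (1 / 2) (by norm_num), hlt N le_rfl _ (by norm_num) (by norm_num), rfl⟩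
  have hγbdd := hbdd (fun h => ∀ x, h x < d x) fun h hh x => (hh x).le
  have hβbdd := hbdd (fun h => ∀ x, h x ≤ d x) fun h hh => hh
  have hβγ : β ≤ γ := by
    rw [hβ, hγ]
    refine csInf_le_csInf hβbdd hγne ?_
    rintro _ ⟨h, hh, hl, rfl⟩
    exact ⟨h, hh, fun x => (hl x).le, rfl⟩
  have hωβ : ω ≤ β := by
    rw [hβ]
    refine le_csInf (hγne.mono ?_) ?_
    · rintro _ ⟨h, hh, hl, rfl⟩
      exact ⟨h, hh, fun x => (hl x).le, rfl⟩
    · rintro _ ⟨h, hh, hl, rfl⟩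
      have := hωlt h 0 _ (h𝒜 h hh) (fun x => le_ciSup (hsub h (h𝒜 h hh)) x)
        (fun x => by linarith [hl x])
      linarith
  have hγω : γ ≤ ω := by
    rw [hω]
    refine le_ciInf fun n => le_of_forall_pos_le_add fun ε hε => ?_
    obtain ⟨t, ht, ht1⟩ := exists_between (max_lt one_pos (sub_lt_self (1 : ℝ) hε))
    obtain ⟨ht0, htε⟩ := max_lt_iff.1 ht
    have hm := le_max_left N n
    rw [hγ]
    refine (csInf_le hγbdd ⟨_, hmem _ hm t ht0, hlt _ hm t ht0 ht1, rfl⟩).trans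
      (ciSup_le fun x => ?_)
    have h2 := le_ciSup (hsub _ (hH n)) x
    have h3 : H n x ≤ H (max N n) x := hmono (le_max_right N n) x
    have h4 := h1 (max N n) x
    have h5 := h0 (max N n) x
    simp only [Pi.smul_apply, smul_eq_mul] at h2 ⊢
    nlinarith
  have hαβ : α ≤ β := by
    rw [hα, hβ]
    refine csInf_le_csInf ⟨0, ?_⟩ (hγne.mono ?_) ?_
    · rintro _ ⟨h, -, rfl⟩
      exact Real.iSup_nonneg fun x => abs_nonneg _
    · rintro _ ⟨h, hh, hl, rfl⟩
      exact ⟨h, hh, fun x => (hl x).le, rfl⟩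
    · rintro _ ⟨h, hh, hl, rfl⟩
      exact ⟨h, hh, iSup_congr fun x => (abs_of_nonneg (sub_nonneg.2 (hl x))).symm⟩
  have hω2α : ω / 2 ≤ α := by
    rw [hα]
    refine le_csInf ⟨_, _, hmem N le_rfl 1 one_pos, rfl⟩ ?_
    rintro _ ⟨h, hh, rfl⟩
    have hx := fun x => abs_le.1 (le_ciSup (habs h (h𝒜 h hh)) x)
    have := hωlt h (⨆ x, |d x - h x|) _ (h𝒜 h hh) (fun x => (hx x).2) (fun x => by linarith [(hx x).1])
    linarith
  exact ⟨hαβ, le_antisymm hβγ (hγω.trans hωβ), le_antisymm hγω (hωβ.trans hβγ), by linarith⟩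

end MonotoneLimit

section CutOff

theorem continuous_fE (ε : ℝ) : Continuous (fE ε) := by
  unfold fE
  fun_prop

theorem fE_nonneg (ε t : ℝ) : 0 ≤ fE ε t := le_min zero_le_one (le_max_left _ _)

theorem fE_le_one (ε t : ℝ) : fE ε t ≤ 1 := min_le_left _ _

theorem fE_anti {ε δ t : ℝ} (hδ : 0 < δ) (hδε : δ ≤ ε) (ht : 0 ≤ t) : fE ε t ≤ fE δ t := by
  have hε : 0 < ε := hδ.trans_le hδε
  unfold fE
  rw [sub_div, sub_div, div_self hε.ne', div_self hδ.ne']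
  gcongr

theorem le_of_fE_eq_zero {ε t : ℝ} (hε : 0 < ε) (h : fE ε t = 0) : t ≤ ε := by
  by_contra! hlt
  have : 0 < fE ε t :=
    lt_min one_pos (lt_max_of_lt_right (div_pos (sub_pos.2 hlt) hε))
  exact this.ne' h

end CutOff

section PositiveElements

variable [PartialOrder A] [StarOrderedRing A]

theorem cfc_fE_nonneg (ε : ℝ) (a : A) : 0 ≤ cfc (fE ε) a :=
  cfc_nonneg fun x _ => fE_nonneg ε x

theorem monotone_cfc_fE {a : A} (ha : 0 ≤ a) :
    Monotone fun n : ℕ => cfc (fE (1 / (n + 1 : ℝ))) a := by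
  intro m n hmn
  refine cfc_mono (fun x hx => fE_anti (by positivity) (by gcongr)
    (spectrum_nonneg_of_nonneg ha hx)) (continuous_fE _).continuousOn (continuous_fE _).continuousOn

theorem exists_cfc_fE_ne_zero {a : A} (ha : 0 ≤ a) (ha0 : a ≠ 0) :
    ∃ n : ℕ, cfc (fE (1 / (n + 1 : ℝ))) a ≠ 0 := by
  by_contra! h
  have hsa : IsSelfAdjoint a := ha.isSelfAdjoint
  refine ha0 ?_
  rw [← cfc_id ℝ a, ← cfc_zero ℝ a]
  refine cfc_congr fun x hx => le_antisymm ?_ (spectrum_nonneg_of_nonneg ha hx)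
  refine ge_of_tendsto' tendsto_one_div_add_atTop_nhds_zero_nat fun n => ?_
  have hn : cfc (fE (1 / (n + 1 : ℝ))) a = cfc (0 : ℝ → ℝ) a := by rw [h n, cfc_zero]
  have hn := (cfc_eq_cfc_iff_eqOn (ha := hsa) (hf := (continuous_fE _).continuousOn)
    (hg := continuousOn_const)).1 hn
  exact le_of_fE_eq_zero (by positivity) (hn hx)

end PositiveElements

namespace IsTracialState

variable [PartialOrder A] [StarOrderedRing A] {τ : A →L[ℂ] ℂ}

/-- The positive linear map underlying a functional that is nonnegative on squares. -/
noncomputable def toPositiveLinearMap (hτ : ∀ x : A, 0 ≤ τ (star x * x)) : A →ₚ[ℂ] ℂ :=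
  PositiveLinearMap.mk₀ (τ : A →ₗ[ℂ] ℂ) fun x hx => by
    obtain ⟨y, rfl⟩ := CStarAlgebra.nonneg_iff_eq_star_mul_self.1 hx
    exact hτ y

theorem mono (hτ : ∀ x : A, 0 ≤ τ (star x * x)) {x y : A} (h : x ≤ y) : (τ x).re ≤ (τ y).re :=
  (Complex.le_def.1 ((toPositiveLinearMap hτ).monotone' h)).1

/-- The Cauchy–Schwarz inequality. -/
theorem norm_apply_star_mul_sq_le (hτ : ∀ x : A, 0 ≤ τ (star x * x)) (x y : A) :
    ‖τ (star x * y)‖ ^ 2 ≤ (τ (star x * x)).re * (τ (star y * y)).re := by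
  let f := toPositiveLinearMap hτ
  have h := norm_inner_le_norm (𝕜 := ℂ) (f.toPreGNS x) (f.toPreGNS y)
  have h2 := pow_le_pow_left₀ (norm_nonneg _) h 2
  rw [mul_pow, f.preGNS_norm_def, f.preGNS_norm_def, Real.sq_sqrt, Real.sq_sqrt] at h2
  · exact h2
  · exact (Complex.le_def.1 (hτ y)).1
  · exact (Complex.le_def.1 (hτ x)).1

theorem norm_le_apply_one_re (hτ : ∀ x : A, 0 ≤ τ (star x * x)) : ‖τ‖ ≤ (τ 1).re := by
  have h1 : 0 ≤ (τ 1).re := by simpa using (Complex.le_def.1 (hτ 1)).1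
  refine τ.opNorm_le_bound h1 fun x => ?_
  have hcs := norm_apply_star_mul_sq_le hτ 1 x
  have hx : (τ (star x * x)).re ≤ ‖x‖ ^ 2 * (τ 1).re := by
    have := mono hτ (CStarAlgebra.star_mul_le_algebraMap_norm_sq (a := x))
    simpa [Algebra.algebraMap_eq_smul_one, ← Complex.coe_smul, ← Complex.ofReal_pow] using this
  simp only [star_one, one_mul, mul_one] at hcs
  refine le_of_sq_le_sq ?_ (by positivity)
  nlinarith

theorem apply_one [Nontrivial A] (hτ : IsTracialState τ) : τ 1 = 1 := by
  have him : (τ 1).im = 0 := by simpa using (Complex.le_def.1 (hτ.1 1)).2.symm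
  have h1 := norm_le_apply_one_re hτ.1
  have h2 := (Complex.re_le_norm _).trans (τ.le_opNorm 1)
  rw [hτ.2.1] at h1 h2
  rw [norm_one, mul_one] at h2
  exact Complex.ext (le_antisymm h2 h1) him

theorem norm_eq_one [Nontrivial A] (hτ : ∀ x : A, 0 ≤ τ (star x * x)) (h1 : τ 1 = 1) :
    ‖τ‖ = 1 := by
  refine le_antisymm (by simpa [h1] using norm_le_apply_one_re hτ) ?_
  simpa [h1] using τ.le_opNorm 1

/-- Tracial states on a simple C*-algebra are faithful. -/
theorem apply_re_pos [IsSimpleRing A] (hτ : IsTracialState τ) {x : A} (hx : 0 ≤ x)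
    (hx0 : x ≠ 0) : 0 < (τ x).re := by
  refine lt_of_le_of_ne (by simpa using mono hτ.1 hx) fun h0 => ?_
  let I : TwoSidedIdeal A := TwoSidedIdeal.mk' {z | ∀ w, τ (w * z) = 0} (by simp)
    (fun {x y} hx hy w => by rw [mul_add, map_add, hx, hy, add_zero])
    (fun {x} hx w => by rw [mul_neg, map_neg, hx, neg_zero])
    (fun {x y} hy w => by rw [← mul_assoc, hy])
    (fun {x y} hx w => by rw [← mul_assoc, hτ.2.2, ← mul_assoc, hx])
  have hI : ∀ z, z ∈ I ↔ ∀ w, τ (w * z) = 0 := fun z => by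
    simp only [I, TwoSidedIdeal.mem_mk', Set.mem_ofPred_eq]
  obtain ⟨y, rfl⟩ := CStarAlgebra.nonneg_iff_eq_star_mul_self.1 hx
  have hmem : star y * y ∈ I := (hI _).2 fun w => by
    have h := norm_apply_star_mul_sq_le hτ.1 (y * star w) y
    rw [← h0, mul_zero, star_mul, star_star, mul_assoc] at h
    simpa using le_antisymm h (sq_nonneg _)
  have := (hI 1).1 (IsSimpleRing.one_mem_of_ne_zero_mem I hx0 hmem) 1
  rw [mul_one, hτ.apply_one] at this
  exact one_ne_zero this

end IsTracialState

section TraceSpace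

theorem isInducing_toWeakDual (S : Set (A →L[ℂ] ℂ)) :
    @Topology.IsInducing _ _ (wstar S) _
      fun φ : S => StrongDual.toWeakDual (φ : A →L[ℂ] ℂ) := by
  let _ := wstar S
  refine ⟨?_⟩
  exact (induced_compose (tγ := Pi.topologicalSpace)
    (f := fun φ : S => StrongDual.toWeakDual (φ : A →L[ℂ] ℂ))
    (g := fun (φ : WeakDual ℂ A) (x : A) => φ x)).symm

theorem continuous_apply_re (S : Set (A →L[ℂ] ℂ)) (x : A) :
    IsWstarContinuous fun φ : S => ((φ : A →L[ℂ] ℂ) x).re := by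
  let _ := wstar S
  exact Complex.continuous_re.comp
    ((continuous_apply x).comp (continuous_induced_dom (f := fun φ : S => ⇑(φ : A →L[ℂ] ℂ))))

variable [PartialOrder A] [StarOrderedRing A]

theorem compactSpace_traceSet [Nontrivial A] :
    @CompactSpace (traceSet A) (wstar (traceSet A)) := by
  let _ := wstar (traceSet A)
  refine ⟨(isInducing_toWeakDual _).isCompact_iff.2 ?_⟩
  have hK : (fun φ : traceSet A => StrongDual.toWeakDual (φ : A →L[ℂ] ℂ)) '' Set.univ =
      (WeakDual.toStrongDual ⁻¹' Metric.closedBall (0 : StrongDual ℂ A) 1) ∩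
        ({φ | ∀ x : A, 0 ≤ φ (star x * x)} ∩ ({φ | φ 1 = 1} ∩
          {φ | ∀ x y : A, φ (x * y) = φ (y * x)})) := by
    ext φ
    constructor
    · rintro ⟨⟨τ, hτ⟩, -, rfl⟩
      exact ⟨by simpa using hτ.2.1.le, hτ.1, hτ.apply_one, hτ.2.2⟩
    · rintro ⟨-, h1, h2, h3⟩
      exact ⟨⟨WeakDual.toStrongDual φ, h1, IsTracialState.norm_eq_one h1 h2, h3⟩, trivial, rfl⟩
  rw [hK]
  refine (WeakDual.isCompact_closedBall _ _).inter_right ?_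
  have hev := fun x : A => WeakDual.eval_continuous (𝕜 := ℂ) x
  refine IsClosed.inter ?_ (IsClosed.inter (isClosed_eq (hev 1) continuous_const) ?_)
  · simp only [Set.ofPred_forall]
    exact isClosed_iInter fun x => isClosed_le continuous_const (hev _)
  · simp only [Set.ofPred_forall]
    exact isClosed_iInter fun x => isClosed_iInter fun y => isClosed_eq (hev _) (hev _)

end TraceSpace

/-- Proposition 3.8: with `𝒜` the set of continuous affine functions on `T(A)` which are
identically zero or strictly positive, and `α`, `β`, `γ` the three approximation quantities,
one has `α ≤ β = γ = ω(a) ≤ 2α`. -/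
theorem osc_eq_dist_to_affine [IsSimpleRing A] [PartialOrder A] [StarOrderedRing A]
    (hT : (traceSet A).Nonempty) (a : A) (ha : 0 ≤ a) (ha0 : a ≠ 0)
    (𝒜 : Set (↥(traceSet A) → ℝ))
    (h𝒜 : 𝒜 = {h | IsWstarContinuous h ∧ IsAffineOn h ∧
      ((∀ τ, h τ = 0) ∨ (∀ τ, 0 < h τ))})
    (α β γ : ℝ)
    (hα : α = sInf {r : ℝ | ∃ h ∈ 𝒜,
      r = ⨆ τ : ↥(traceSet A), |dTau (τ : A →L[ℂ] ℂ) a - h τ|})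
    (hβ : β = sInf {r : ℝ | ∃ h ∈ 𝒜, (∀ τ : ↥(traceSet A), h τ ≤ dTau (τ : A →L[ℂ] ℂ) a) ∧
      r = ⨆ τ : ↥(traceSet A), (dTau (τ : A →L[ℂ] ℂ) a - h τ)})
    (hγ : γ = sInf {r : ℝ | ∃ h ∈ 𝒜, (∀ τ : ↥(traceSet A), h τ < dTau (τ : A →L[ℂ] ℂ) a) ∧
      r = ⨆ τ : ↥(traceSet A), (dTau (τ : A →L[ℂ] ℂ) a - h τ)}) :
    α ≤ β ∧ β = γ ∧ γ = osc a ∧ osc a ≤ 2 * α := by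
  let _ := wstar (traceSet A)
  have : CompactSpace (traceSet A) := compactSpace_traceSet
  have : Nonempty (traceSet A) := hT.to_subtype
  obtain ⟨N, hN⟩ := exists_cfc_fE_ne_zero ha ha0
  let H : ℕ → traceSet A → ℝ :=
    fun n τ => ((τ : A →L[ℂ] ℂ) (cfc (fE (1 / (n + 1 : ℝ))) a)).re
  have hH : ∀ n, Continuous (H n) := fun n => continuous_apply_re _ _
  have hmono : Monotone H := fun m n hmn τ =>
    IsTracialState.mono τ.2.1 (monotone_cfc_fE ha hmn)
  have hpos : ∀ τ, 0 < H N τ := fun τ => τ.2.apply_re_pos (cfc_fE_nonneg _ a) hN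
  refine iInf_iSup_sub_eq_sInf hH hmono
    (fun n τ => by simpa using IsTracialState.mono τ.2.1 (cfc_fE_nonneg _ a))
    (fun n τ => by
      simpa [H, τ.2.apply_one] using
        IsTracialState.mono τ.2.1 (cfc_le_one (fE (1 / (n + 1 : ℝ))) a fun x _ => fE_le_one _ x))
    (fun h hh => ?_) hpos (fun n hn t ht => ?_) (fun _ => rfl) hα hβ hγ rfl
  · rw [h𝒜] at hh
    exact hh.1
  · rw [h𝒜]
    refine ⟨(hH n).const_smul t, fun φ ψ s _ hmem => ?_, Or.inr fun τ => ?_⟩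
    · simp [H]
      ring
    · exact mul_pos ht ((hpos τ).trans_le (hmono hn τ))
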